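/- Ramanujan's identity: Li₂(1/3) − (1/6)·Li₂(1/9) = π²/18 − (1/6)·(ln 3)². -/

import Mathlib

open Real

/-- The dilogarithm, `Li₂(z) = ∑_{k=1}^∞ z^k / k²`. -/
noncomputable def Li2 (z : ℝ) : ℝ := ∑' k : ℕ, z ^ (k + 1) / ((k : ℝ) + 1) ^ 2

theorem summable_one_div_add_one_sq : Summable fun k : ℕ => 1 / ((k : ℝ) + 1) ^ 2 := by
  have h := (summable_nat_add_iff 1).2 (Real.summable_one_div_nat_pow.2 one_lt_two)
  simpa using h

theorem norm_Li2_term_le {z : ℝ} (hz : |z| ≤ 1) (k : ℕ) :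
    ‖z ^ (k + 1) / ((k : ℝ) + 1) ^ 2‖ ≤ 1 / ((k : ℝ) + 1) ^ 2 := by
  rw [norm_div, norm_pow, Real.norm_eq_abs, Real.norm_of_nonneg (by positivity)]
  gcongr
  exact pow_le_one₀ (abs_nonneg z) hz

theorem hasSum_Li2 {z : ℝ} (hz : |z| ≤ 1) :
    HasSum (fun k : ℕ => z ^ (k + 1) / ((k : ℝ) + 1) ^ 2) (Li2 z) :=
  (Summable.of_norm_bounded summable_one_div_add_one_sq (norm_Li2_term_le hz)).hasSum

theorem continuousOn_Li2 : ContinuousOn Li2 (Set.Icc (-1) 1) := by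
  refine continuousOn_tsum (fun k => by fun_prop) summable_one_div_add_one_sq ?_
  exact fun k z hz => norm_Li2_term_le (abs_le.2 hz) k

theorem Li2_zero : Li2 0 = 0 := by simp [Li2]

theorem Li2_one : Li2 1 = π ^ 2 / 6 := by
  have h := (hasSum_nat_add_iff' 1).2 hasSum_zeta_two
  simpa [Li2] using h.tsum_eq

theorem hasDerivAt_Li2 {z : ℝ} (hz : |z| < 1) (hz0 : z ≠ 0) :
    HasDerivAt Li2 (-log (1 - z) / z) z := by
  obtain ⟨r, hzr, hr1⟩ := exists_between hz
  have hr0 : 0 < r := (abs_nonneg z).trans_lt hzr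
  have h : HasDerivAt Li2 (∑' k : ℕ, z ^ k / ((k : ℝ) + 1)) z := by
    refine hasDerivAt_tsum_of_isPreconnected (t := Metric.ball (0 : ℝ) r) (y₀ := 0)
      (g' := fun (k : ℕ) (y : ℝ) => y ^ k / ((k : ℝ) + 1))
      (summable_geometric_of_lt_one hr0.le hr1) Metric.isOpen_ball
      (convex_ball (0 : ℝ) r).isPreconnected (fun k y _ => ?_) (fun k y hy => ?_)
      (Metric.mem_ball_self hr0) (hasSum_Li2 (by simp)).summable (by simpa using hzr)
    · refine ((hasDerivAt_pow (k + 1) y).div_const (((k : ℝ) + 1) ^ 2)).congr_deriv ?_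
      rw [Nat.add_sub_cancel, Nat.cast_add_one]
      field_simp
    · have hy' : |y| < r := by simpa using hy
      rw [norm_div, norm_pow, Real.norm_eq_abs, Real.norm_of_nonneg (by positivity)]
      calc |y| ^ k / ((k : ℝ) + 1) ≤ |y| ^ k := div_le_self (by positivity) (by simp)
        _ ≤ r ^ k := by gcongr
  convert h using 1
  rw [← ((Real.hasSum_pow_div_log_of_abs_lt_one hz).div_const z).tsum_eq]
  refine tsum_congr fun k => ?_
  rw [pow_succ]
  field_simp

/-- The duplication formula for the dilogarithm. -/
theorem Li2_sq {z : ℝ} (hz : |z| ≤ 1) : Li2 (z ^ 2) = 2 * (Li2 z + Li2 (-z)) := by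
  have hsum := (hasSum_Li2 hz).add (hasSum_Li2 (z := -z) (by simpa using hz))
  have hsq : |z ^ 2| ≤ 1 := by
    rw [abs_pow]
    exact pow_le_one₀ (abs_nonneg z) hz
  have heven : HasSum (fun k : ℕ => z ^ (2 * k + 1) / (((2 * k : ℕ) : ℝ) + 1) ^ 2 +
      (-z) ^ (2 * k + 1) / (((2 * k : ℕ) : ℝ) + 1) ^ 2) 0 := by
    refine hasSum_zero.congr_fun fun k => ?_
    rw [(odd_two_mul_add_one k).neg_pow]
    ring
  have hodd : HasSum (fun k : ℕ => z ^ (2 * k + 1 + 1) / (((2 * k + 1 : ℕ) : ℝ) + 1) ^ 2 +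
      (-z) ^ (2 * k + 1 + 1) / (((2 * k + 1 : ℕ) : ℝ) + 1) ^ 2) (Li2 (z ^ 2) / 2) := by
    refine ((hasSum_Li2 hsq).div_const 2).congr_fun fun k => ?_
    rw [show 2 * k + 1 + 1 = 2 * (k + 1) by ring, (even_two_mul (k + 1)).neg_pow, pow_mul]
    push_cast
    rw [show 2 * (k : ℝ) + 1 + 1 = 2 * (k + 1) by ring]
    field_simp
    ring
  have h := hsum.unique (HasSum.even_add_odd heven hodd)
  linarith

/-- Landen's identity for the dilogarithm. -/
theorem Li2_add_Li2_div_sub_one {x : ℝ} (hx0 : 0 < x) (hx : x ≤ 1 / 2) :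
    Li2 x + Li2 (x / (x - 1)) = -(1 / 2) * log (1 - x) ^ 2 := by
  have hcont : ContinuousOn
      (fun t => Li2 t + Li2 (t / (t - 1)) + 1 / 2 * log (1 - t) ^ 2) (Set.Icc 0 x) := by
    have hmaps : Set.MapsTo (fun t : ℝ => t / (t - 1)) (Set.Icc 0 x) (Set.Icc (-1) 1) := by
      rintro t ⟨ht0, htx⟩
      have : t - 1 < 0 := by linarith
      exact ⟨by rw [le_div_iff_of_neg this]; linarith, by rw [div_le_iff_of_neg this]; linarith⟩
    refine ((continuousOn_Li2.mono (Set.Icc_subset_Icc (by norm_num) (by linarith))).add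
      (continuousOn_Li2.comp (ContinuousOn.div (by fun_prop) (by fun_prop) ?_) hmaps)).add
      (continuousOn_const.mul ((ContinuousOn.log (by fun_prop) ?_).pow 2))
    all_goals
      rintro t ⟨ht0, htx⟩
      intro h
      linarith
  have hderiv : ∀ t ∈ Set.Ioo 0 x, HasDerivAt
      (fun t => Li2 t + Li2 (t / (t - 1)) + 1 / 2 * log (1 - t) ^ 2) 0 t := by
    rintro t ⟨ht0, htx⟩
    have hneg : t - 1 < 0 := by linarith
    have hpos : 0 < 1 - t := by linarith
    have hw : |t / (t - 1)| < 1 := by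
      rw [abs_lt]
      exact ⟨by rw [lt_div_iff_of_neg hneg]; linarith, by rw [div_lt_iff_of_neg hneg]; linarith⟩
    have h1 := hasDerivAt_Li2 (z := t) (abs_lt.2 ⟨by linarith, by linarith⟩) ht0.ne'
    have h2 := (hasDerivAt_Li2 hw (div_ne_zero ht0.ne' hneg.ne)).comp t
      ((hasDerivAt_id t).div ((hasDerivAt_id t).sub_const 1) hneg.ne)
    have h3 := ((((hasDerivAt_id t).const_sub 1).log hpos.ne').pow 2).const_mul (1 / 2)
    have hlog : log (1 - t / (t - 1)) = -log (1 - t) := by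
      rw [← log_inv]
      congr 1
      field_simp [hneg.ne, hpos.ne']
      ring
    refine ((h1.add h2).add h3).congr_deriv ?_
    simp only [id, hlog]
    have hn := hneg.ne
    have hp := hpos.ne'
    rw [show t - 1 = -(1 - t) by ring]
    field_simp
    ring
  obtain ⟨c, -, hc⟩ := exists_hasDerivAt_eq_slope _ _ hx0 hcont hderiv
  have hc' := (div_eq_zero_iff.1 hc.symm).resolve_right (by linarith)
  simp only [zero_div, Li2_zero, sub_zero, log_one] at hc'
  linarith

theorem stmt_15 :
    Li2 (1 / 3) - (1 / 6) * Li2 (1 / 9) =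
      Real.pi ^ 2 / 18 - (1 / 6) * (Real.log 3) ^ 2 := by
  have hdup (z : ℝ) (hz0 : 0 ≤ z) (hz1 : z ≤ 1) : Li2 (z ^ 2) = 2 * (Li2 z + Li2 (-z)) :=
    Li2_sq (abs_le.2 ⟨by linarith, hz1⟩)
  have d1 := hdup 1 (by norm_num) (by norm_num)
  have d2 := hdup (1 / 2) (by norm_num) (by norm_num)
  have d3 := hdup (1 / 3) (by norm_num) (by norm_num)
  have l2 := Li2_add_Li2_div_sub_one (x := 1 / 2) (by norm_num) (by norm_num)
  have l3 := Li2_add_Li2_div_sub_one (x := 1 / 3) (by norm_num) (by norm_num)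
  have l4 := Li2_add_Li2_div_sub_one (x := 1 / 4) (by norm_num) (by norm_num)
  rw [one_pow, Li2_one] at d1
  rw [show ((1 : ℝ) / 2) ^ 2 = 1 / 4 by norm_num] at d2
  rw [show ((1 : ℝ) / 3) ^ 2 = 1 / 9 by norm_num] at d3
  rw [show (1 : ℝ) / 2 / (1 / 2 - 1) = -1 by norm_num,
    show (1 : ℝ) - 1 / 2 = 2⁻¹ by norm_num, log_inv] at l2
  rw [show (1 : ℝ) / 3 / (1 / 3 - 1) = -(1 / 2) by norm_num,
    show (1 : ℝ) - 1 / 3 = 2 / 3 by norm_num, log_div (by norm_num) (by norm_num)] at l3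
  rw [show (1 : ℝ) / 4 / (1 / 4 - 1) = -(1 / 3) by norm_num,
    show (1 : ℝ) - 1 / 4 = 3 / 2 ^ 2 by norm_num, log_div (by norm_num) (by norm_num),
    log_pow] at l4
  push_cast at l4
  linarith
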